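/- For Re(d) > 0, ₃F₂(a, 1-a, d+1; c+1, d; 1/2) = 2^{-c} Γ(1/2) Γ(c+1) · { (2/d) / (Γ((a+c)/2) Γ((c-a+1)/2)) + (1 - c/d) / (Γ((a+c+1)/2) Γ((c-a)/2 + 1)) }. -/

import Mathlib

open Complex Set MeasureTheory

/-- Pochhammer symbol `(a)_n` on the complex numbers. -/
noncomputable def poch (a : ℂ) (n : ℕ) : ℂ := (ascPochhammer ℂ n).eval a

/-- Generalized hypergeometric series with numerator parameters `as` and
denominator parameters `bs`, evaluated at `z`. -/
noncomputable def hyp (as bs : List ℂ) (z : ℂ) : ℂ :=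
  ∑' n : ℕ, ((as.map fun a => poch a n).prod /
    ((bs.map fun b => poch b n).prod * (n.factorial : ℂ))) * z ^ n

section

open Filter Topology

/-- The part of the coefficients of `₂F₁(a, 1 - a; c; 1/2)` that does not depend on `c`. -/
noncomputable def baileyCoeff (a : ℂ) (n : ℕ) : ℂ :=
  poch a n * poch (1 - a) n / (n.factorial : ℂ) * (1 / 2) ^ n

/-- The regularized series `₂F₁(a, 1 - a; c; 1/2) / Γ(c)`. -/
noncomputable def baileySeries (a c : ℂ) : ℂ :=
  ∑' n : ℕ, baileyCoeff a n * (Gamma (c + n))⁻¹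

lemma poch_zero (a : ℂ) : poch a 0 = 1 := by simp [poch]

lemma poch_succ (a : ℂ) (n : ℕ) : poch a (n + 1) = poch a n * (a + n) :=
  ascPochhammer_succ_eval n a

lemma poch_add_one_mul (d : ℂ) (n : ℕ) : poch (d + 1) n * d = poch d n * (d + n) := by
  induction n with
  | zero => simp [poch_zero]
  | succ n ih =>
    rw [poch_succ, poch_succ, mul_right_comm, ih]
    push_cast
    ring

lemma Gamma_mul_inv_Gamma_add_nat {z : ℂ} (hz : ∀ m : ℕ, z ≠ -m) (n : ℕ) :
    Gamma z * (Gamma (z + n))⁻¹ = (poch z n)⁻¹ := by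
  rw [poch, ← Complex.Gamma_add_nat_div_Gamma_eq z hz, inv_div, div_eq_mul_inv]

lemma ne_neg_nat_of_re_pos {z : ℂ} (hz : 0 < z.re) (m : ℕ) : z ≠ -m := by
  rintro rfl
  simp only [neg_re, natCast_re] at hz
  linarith [(Nat.cast_nonneg m : (0 : ℝ) ≤ m)]

lemma poch_ne_zero {z : ℂ} (hz : ∀ m : ℕ, z ≠ -m) (n : ℕ) : poch z n ≠ 0 := by
  induction n with
  | zero => simp [poch_zero]
  | succ n ih =>
    rw [poch_succ]
    exact mul_ne_zero ih fun h => hz n (eq_neg_of_add_eq_zero_left h)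

lemma poch_inv_eq_prod (z : ℂ) (n : ℕ) : (poch z n)⁻¹ = ∏ j ∈ Finset.range n, (z + j)⁻¹ := by
  induction n with
  | zero => simp [poch_zero]
  | succ n ih => rw [poch_succ, mul_inv, ih, Finset.prod_range_succ]

lemma baileyCoeff_succ (a : ℂ) (n : ℕ) :
    baileyCoeff a (n + 1) = baileyCoeff a n * ((a + n) * (1 - a + n) / (2 * (n + 1))) := by
  have h₁ : (n.factorial : ℂ) ≠ 0 := by exact_mod_cast n.factorial_ne_zero
  have h₂ : (n + 1 : ℂ) ≠ 0 := by exact_mod_cast n.succ_ne_zero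
  rw [baileyCoeff, baileyCoeff, poch_succ, poch_succ, Nat.factorial_succ, pow_succ]
  push_cast
  field_simp

lemma summable_baileyCoeff (a c : ℂ) :
    Summable fun n : ℕ => baileyCoeff a n * (Gamma (c + n))⁻¹ := by
  have hr : Tendsto (fun n : ℕ => ‖(a + n) / (1 + n) * ((1 - a + n) / (c + n)) * (1 / 2)‖)
      atTop (𝓝 (1 / 2)) := by
    have h₁ := tendsto_add_mul_div_add_mul_atTop_nhds a 1 1 (one_ne_zero' ℂ)
    have h₂ := tendsto_add_mul_div_add_mul_atTop_nhds (1 - a) c 1 (one_ne_zero' ℂ)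
    simpa using ((h₁.mul h₂).mul_const (1 / 2 : ℂ)).norm
  have hc : ∀ᶠ n : ℕ in atTop, c + n ≠ 0 := by
    filter_upwards [eventually_gt_atTop ⌈‖c‖⌉₊] with n hn h
    have : ‖c‖ = n := by rw [eq_neg_of_add_eq_zero_left h]; simp
    exact absurd (Nat.lt_of_ceil_lt hn) (by simp [this])
  refine summable_of_ratio_norm_eventually_le (r := 3 / 4) (by norm_num) ?_
  filter_upwards [hr.eventually_le_const (by norm_num : (1 / 2 : ℝ) < 3 / 4), hc] with n hn hcn
  have h : baileyCoeff a (n + 1) * (Gamma (c + (n + 1 : ℕ)))⁻¹ =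
      ((a + n) / (1 + n) * ((1 - a + n) / (c + n)) * (1 / 2)) *
        (baileyCoeff a n * (Gamma (c + n))⁻¹) := by
    have h₂ : (n + 1 : ℂ) ≠ 0 := by exact_mod_cast n.succ_ne_zero
    rw [baileyCoeff_succ, one_div_Gamma_eq_self_mul_one_div_Gamma_add_one (c + n)]
    push_cast
    rw [← add_assoc, add_comm (1 : ℂ) n]
    generalize (Gamma (c + n + 1))⁻¹ = g
    field_simp
  rw [h, norm_mul]
  gcongr

lemma nat_mul_baileyCoeff (a c : ℂ) (n : ℕ) :
    n * (baileyCoeff a n * (Gamma (c + 1 + n))⁻¹) =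
      baileyCoeff a n * (Gamma (c + n))⁻¹ - c * (baileyCoeff a n * (Gamma (c + 1 + n))⁻¹) := by
  rw [one_div_Gamma_eq_self_mul_one_div_Gamma_add_one (c + n), add_right_comm]
  ring

/-- The contiguous relation for `₂F₁(a, 1 - a; c; 1/2)`, in regularized form. -/
lemma baileySeries_eq_mul_add_two (a c : ℂ) :
    baileySeries a c = (c + a) * (c + 1 - a) * baileySeries a (c + 2) := by
  set U : ℕ → ℂ := fun n => n * (baileyCoeff a n * (Gamma (c + 1 + n))⁻¹)
  have hU : Summable U := by
    refine ((summable_baileyCoeff a c).sub ((summable_baileyCoeff a (c + 1)).mul_left c)).congr ?_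
    intro n
    exact (nat_mul_baileyCoeff a c n).symm
  have hstep (n : ℕ) : baileyCoeff a n * (Gamma (c + n))⁻¹ -
      (c + a) * (c + 1 - a) * (baileyCoeff a n * (Gamma (c + 2 + n))⁻¹) =
        2 * U n - 2 * U (n + 1) := by
    have h₂ : (n + 1 : ℂ) ≠ 0 := by exact_mod_cast n.succ_ne_zero
    simp only [U]
    rw [baileyCoeff_succ, one_div_Gamma_eq_self_mul_one_div_Gamma_add_one (c + n),
      one_div_Gamma_eq_self_mul_one_div_Gamma_add_one (c + n + 1),
      one_div_Gamma_eq_self_mul_one_div_Gamma_add_one (c + 1 + n)]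
    push_cast
    rw [show c + n + 1 + 1 = c + 2 + n by ring, show c + 1 + n + 1 = c + 2 + n by ring,
      show c + 1 + (n + 1 : ℂ) = c + 2 + n by ring]
    generalize (Gamma (c + 2 + n))⁻¹ = g
    field_simp
    ring
  have hU' : Summable fun n => U (n + 1) := (summable_nat_add_iff 1).2 hU
  have h₀ : ∑' n, U n = ∑' n, U (n + 1) := by
    rw [hU.tsum_eq_zero_add]
    simp [U]
  rw [← sub_eq_zero, baileySeries, baileySeries, ← tsum_mul_left,
    ← (summable_baileyCoeff a c).tsum_sub ((summable_baileyCoeff a (c + 2)).mul_left _),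
    tsum_congr hstep, (hU.mul_left 2).tsum_sub (hU'.mul_left 2), tsum_mul_left, tsum_mul_left,
    h₀, sub_self]

lemma tendsto_Gamma_mul_baileySeries (a : ℂ) {c : ℂ} (hc : 0 < c.re) :
    Tendsto (fun N : ℕ => Gamma (c + 2 * N) * baileySeries a (c + 2 * N)) atTop (𝓝 1) := by
  have hre (N : ℕ) : 0 < (c + 2 * N).re := by
    simp only [add_re, mul_re, re_ofNat, im_ofNat, natCast_re, natCast_im, mul_zero,
      sub_zero]
    positivity
  have hseries (N : ℕ) : Gamma (c + 2 * N) * baileySeries a (c + 2 * N) =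
      ∑' n, baileyCoeff a n * ∏ j ∈ Finset.range n, (c + 2 * N + j)⁻¹ := by
    rw [baileySeries, ← tsum_mul_left]
    refine tsum_congr fun n => ?_
    rw [mul_left_comm, Gamma_mul_inv_Gamma_add_nat (ne_neg_nat_of_re_pos (hre N)),
      poch_inv_eq_prod]
  have hbound : Summable fun n =>
      ‖baileyCoeff a n * ∏ j ∈ Finset.range n, ((c.re : ℂ) + j)⁻¹‖ := by
    refine (((summable_baileyCoeff a c.re).mul_left (Gamma c.re)).congr fun n => ?_).norm
    rw [mul_left_comm, Gamma_mul_inv_Gamma_add_nat (ne_neg_nat_of_re_pos (by simpa using hc)),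
      poch_inv_eq_prod]
  have hlim : ∑' n, baileyCoeff a n * ∏ _j ∈ Finset.range n, (0 : ℂ) = 1 := by
    rw [tsum_eq_single 0]
    · simp [baileyCoeff, poch_zero]
    · intro n hn
      simp [hn]
  simp_rw [hseries]
  rw [← hlim]
  refine tendsto_tsum_of_dominated_convergence hbound ?_ (Eventually.of_forall fun N n => ?_)
  · intro n
    refine (tendsto_finsetProd _ fun j _ => ?_).const_mul _
    have h : Tendsto (fun N : ℕ => (1 + 0 * (N : ℂ)) / ((c + j) + 2 * N)) atTop (𝓝 (0 / 2)) :=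
      tendsto_add_mul_div_add_mul_atTop_nhds 1 (c + j) 0 two_ne_zero
    rw [zero_div] at h
    refine h.congr fun N => ?_
    rw [zero_mul, add_zero, one_div, add_right_comm]
  · rw [norm_mul, norm_mul, norm_prod, norm_prod]
    gcongr with j
    rw [norm_inv, norm_inv]
    have h₁ : ‖(c.re : ℂ) + j‖ = c.re + j := by
      rw [← ofReal_natCast, ← ofReal_add, norm_real, Real.norm_of_nonneg (by positivity)]
    have h₂ : c.re + j ≤ ‖c + 2 * N + j‖ := by
      refine le_trans ?_ (re_le_norm _)
      simp
    rw [h₁]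
    gcongr

lemma GammaSeq_mul_div_GammaSeq_mul {u v x y : ℂ} (h : u + v = x + y) {n : ℕ} (hn : n ≠ 0) :
    GammaSeq u n * GammaSeq v n / (GammaSeq x n * GammaSeq y n) =
      ∏ k ∈ Finset.range (n + 1), ((x + k) * (y + k) / ((u + k) * (v + k))) := by
  have hn' : (n : ℂ) ≠ 0 := by exact_mod_cast hn
  have hf : (n.factorial : ℂ) ≠ 0 := by exact_mod_cast n.factorial_ne_zero
  have hp (s : ℂ) : (n : ℂ) ^ s ≠ 0 := by simp [cpow_eq_zero_iff, hn']
  have hpow : (n : ℂ) ^ u * (n : ℂ) ^ v = (n : ℂ) ^ x * (n : ℂ) ^ y := by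
    rw [← cpow_add _ _ hn', ← cpow_add _ _ hn', h]
  rw [Finset.prod_div_distrib, Finset.prod_mul_distrib, Finset.prod_mul_distrib]
  simp only [GammaSeq]
  rw [div_mul_div_comm, div_mul_div_comm, div_div_div_eq,
    mul_mul_mul_comm ((n : ℂ) ^ u), mul_mul_mul_comm ((n : ℂ) ^ x), hpow, mul_comm
      ((n : ℂ) ^ x * (n : ℂ) ^ y * _), mul_div_mul_right]
  simp [hp, hf]

lemma baileySeries_eq_of_re_pos {a c : ℂ} (hc : 0 < c.re) (hx : 0 < (c + a).re)
    (hy : 0 < (c + 1 - a).re) :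
    baileySeries a c = (2 : ℂ) ^ (1 - c) * (√Real.pi : ℝ) *
      ((Gamma ((c + a) / 2))⁻¹ * (Gamma ((c + 1 - a) / 2))⁻¹) := by
  set x := (c + a) / 2 with hxdef
  set y := (c + 1 - a) / 2 with hydef
  set u := c / 2 with hudef
  set v := c / 2 + 1 / 2 with hvdef
  have hprod (N : ℕ) : Gamma c * baileySeries a c =
      (∏ k ∈ Finset.range N, ((x + k) * (y + k) / ((u + k) * (v + k)))) *
        (Gamma (c + 2 * N) * baileySeries a (c + 2 * N)) := by
    induction N with
    | zero => simp
    | succ N ih =>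
      have h₁ : c + 2 * N ≠ 0 := by
        intro h
        exact ne_neg_nat_of_re_pos hc (2 * N) (by push_cast; exact eq_neg_of_add_eq_zero_left h)
      have h₂ : c + 2 * N + 1 ≠ 0 := by
        intro h
        exact ne_neg_nat_of_re_pos hc (2 * N + 1)
          (by push_cast; rw [add_assoc] at h; exact eq_neg_of_add_eq_zero_left h)
      have hG : Gamma (c + 2 * (N + 1 : ℕ)) =
          (c + 2 * N + 1) * ((c + 2 * N) * Gamma (c + 2 * N)) := by
        rw [← Gamma_add_one _ h₁, ← Gamma_add_one _ h₂]
        push_cast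
        ring_nf
      have hq : (x + N) * (y + N) / ((u + N) * (v + N)) =
          (c + 2 * N + a) * (c + 2 * N + 1 - a) / ((c + 2 * N) * (c + 2 * N + 1)) := by
        rw [show x + N = (c + 2 * N + a) / 2 by rw [hxdef]; ring,
          show y + N = (c + 2 * N + 1 - a) / 2 by rw [hydef]; ring,
          show u + N = (c + 2 * N) / 2 by rw [hudef]; ring,
          show v + N = (c + 2 * N + 1) / 2 by rw [hvdef]; ring]
        field_simp
      rw [ih, Finset.prod_range_succ, hG, hq, baileySeries_eq_mul_add_two a (c + 2 * N),
        show c + 2 * (N : ℂ) + 2 = c + 2 * (N + 1 : ℕ) by push_cast; ring]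
      field_simp
  have hx' : Gamma x ≠ 0 := by
    refine Gamma_ne_zero_of_re_pos ?_
    rw [hxdef, div_ofNat_re]
    linarith
  have hy' : Gamma y ≠ 0 := by
    refine Gamma_ne_zero_of_re_pos ?_
    rw [hydef, div_ofNat_re]
    linarith
  have hlim : Tendsto (fun n : ℕ => GammaSeq u n * GammaSeq v n / (GammaSeq x n * GammaSeq y n) *
      (Gamma (c + 2 * (n + 1 : ℕ)) * baileySeries a (c + 2 * (n + 1 : ℕ)))) atTop
      (𝓝 (Gamma u * Gamma v / (Gamma x * Gamma y) * 1)) :=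
    (((GammaSeq_tendsto_Gamma u).mul (GammaSeq_tendsto_Gamma v)).div
      ((GammaSeq_tendsto_Gamma x).mul (GammaSeq_tendsto_Gamma y)) (mul_ne_zero hx' hy')).mul
      ((tendsto_Gamma_mul_baileySeries a hc).comp (tendsto_add_atTop_nat 1))
  have hconst : Tendsto (fun _ : ℕ => Gamma c * baileySeries a c) atTop
      (𝓝 (Gamma u * Gamma v / (Gamma x * Gamma y) * 1)) := by
    refine hlim.congr' ?_
    filter_upwards [eventually_ne_atTop 0] with n hn
    rw [hprod (n + 1), GammaSeq_mul_div_GammaSeq_mul _ hn]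
    rw [hudef, hvdef, hxdef, hydef]
    ring
  have hval := tendsto_nhds_unique tendsto_const_nhds hconst
  rw [hudef, hvdef, Complex.Gamma_mul_Gamma_add_half, mul_div_cancel₀ c two_ne_zero] at hval
  have hΓ : Gamma c ≠ 0 := Gamma_ne_zero_of_re_pos hc
  apply mul_left_cancel₀ hΓ
  rw [hval]
  field_simp

/-- Bailey's summation theorem, in regularized form. -/
lemma baileySeries_eq (a c : ℂ) :
    baileySeries a c = (2 : ℂ) ^ (1 - c) * (√Real.pi : ℝ) *
      ((Gamma ((c + a) / 2))⁻¹ * (Gamma ((c + 1 - a) / 2))⁻¹) := by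
  obtain ⟨N, hN⟩ := exists_nat_gt (-c.re + |a.re|)
  induction N generalizing c with
  | zero =>
    have h₁ := neg_abs_le a.re
    have h₂ := le_abs_self a.re
    have h₃ := abs_nonneg a.re
    simp only [Nat.cast_zero] at hN
    apply baileySeries_eq_of_re_pos
    · linarith
    · rw [add_re]
      linarith
    · rw [sub_re, add_re, one_re]
      linarith
  | succ N ih =>
    rw [baileySeries_eq_mul_add_two, ih (c + 2),
      one_div_Gamma_eq_self_mul_one_div_Gamma_add_one ((c + a) / 2),
      one_div_Gamma_eq_self_mul_one_div_Gamma_add_one ((c + 1 - a) / 2),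
      show (c + 2 + a) / 2 = (c + a) / 2 + 1 by ring,
      show (c + 2 + 1 - a) / 2 = (c + 1 - a) / 2 + 1 by ring,
      show 1 - c = 1 - (c + 2) + (2 : ℕ) by push_cast; ring,
      cpow_add _ _ two_ne_zero, cpow_natCast]
    · ring
    · push_cast at hN
      rw [add_re, re_ofNat]
      linarith


end

theorem stmt10 (a c d : ℂ) (hd : 0 < d.re)
    (h₁ : (∀ n : ℕ, c + 1 ≠ -(n : ℂ))) (h₂ : (∀ n : ℕ, d ≠ -(n : ℂ))) :
    hyp [a, 1 - a, d + 1] [c + 1, d] (1/2)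
      = (2 : ℂ) ^ (-c) * Complex.Gamma (1/2) * Complex.Gamma (c + 1) *
          ((2 / d) / (Complex.Gamma ((a + c) / 2) * Complex.Gamma ((c - a + 1) / 2)) +
            (1 - c / d) / (Complex.Gamma ((a + c + 1) / 2) * Complex.Gamma ((c - a) / 2 + 1))) := by
  have hd₀ : d ≠ 0 := by simpa using h₂ 0
  have hterm (n : ℕ) : (([a, 1 - a, d + 1].map fun a => poch a n).prod /
      (([c + 1, d].map fun b => poch b n).prod * (n.factorial : ℂ))) * (1 / 2) ^ n =
      Gamma (c + 1) * ((1 / d) * (baileyCoeff a n * (Gamma (c + n))⁻¹) +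
        (1 - c / d) * (baileyCoeff a n * (Gamma (c + 1 + n))⁻¹)) := by
    have hcoeff : Gamma (c + 1) * ((1 / d) * (baileyCoeff a n * (Gamma (c + n))⁻¹) +
        (1 - c / d) * (baileyCoeff a n * (Gamma (c + 1 + n))⁻¹)) =
        baileyCoeff a n * (Gamma (c + 1) * (Gamma (c + 1 + n))⁻¹) * ((d + n) / d) := by
      rw [eq_add_of_sub_eq (nat_mul_baileyCoeff a c n).symm]
      field_simp
      ring
    have hpoch : (d + n) / d = poch (d + 1) n / poch d n := by
      rw [div_eq_div_iff hd₀ (poch_ne_zero h₂ n), poch_add_one_mul, mul_comm]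
    rw [hcoeff, Gamma_mul_inv_Gamma_add_nat h₁, hpoch, baileyCoeff]
    simp only [List.map_cons, List.map_nil, List.prod_cons, List.prod_nil, mul_one]
    have := poch_ne_zero h₁ n
    have := poch_ne_zero h₂ n
    have hf : (n.factorial : ℂ) ≠ 0 := by exact_mod_cast n.factorial_ne_zero
    field_simp
  have hπ : Gamma (1 / 2) = (√Real.pi : ℝ) := by
    rw [← Real.Gamma_one_half_eq, ← Gamma_ofReal]
    norm_num
  have hpow : (2 : ℂ) ^ (1 - c) = 2 * (2 : ℂ) ^ (-c) := by
    rw [sub_eq_add_neg, cpow_add _ _ two_ne_zero, cpow_one]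
  rw [hyp, tsum_congr hterm, tsum_mul_left,
    ((summable_baileyCoeff a c).mul_left _).tsum_add ((summable_baileyCoeff a (c + 1)).mul_left _),
    tsum_mul_left, tsum_mul_left]
  change Gamma (c + 1) * (1 / d * baileySeries a c + (1 - c / d) * baileySeries a (c + 1)) = _
  rw [baileySeries_eq, baileySeries_eq, hπ, hpow, show 1 - (c + 1) = -c by ring,
    show (c + a) / 2 = (a + c) / 2 by ring, show (c + 1 - a) / 2 = (c - a + 1) / 2 by ring,
    show (c + 1 + a) / 2 = (a + c + 1) / 2 by ring,
    show (c + 1 + 1 - a) / 2 = (c - a) / 2 + 1 by ring]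
  simp only [div_eq_mul_inv, mul_inv]
  ring
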